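/- In the dense regime, the higher criticism test achieves the detection boundary: if ε_n = n^{-β} and ρ_n = n^{-γ} with β, γ > 0 fixed such that γ < 1/2 − β, then the sequence of tests that rejects when HC_n ≥ log n is asymptotically powerful, where HC_n := sup_{u ≥ 0} √n (F_n(u) − Ψ(u)) / √(Ψ(u)(1 − Ψ(u))), F_n is the empirical distribution function of |U₁|,…,|Uₙ| with U_i := (X_i − Y_i)/√2, and Ψ(u) := 2Φ(u) − 1. -/

import Mathlib

open MeasureTheory ProbabilityTheory Real Filter Topology

noncomputable section

/-- The standard normal distribution on ℝ. -/
def stdGauss : Measure ℝ := gaussianReal 0 1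

/-- Two independent standard normals. -/
def stdGauss2 : Measure (ℝ × ℝ) := stdGauss.prod stdGauss

/-- `N(0, Σ_ρ)`: the centered bivariate normal with unit marginal variances and
correlation `ρ`, i.e. the law of `(Z₁, ρ Z₁ + √(1-ρ²) Z₂)` for independent standard
normal `Z₁, Z₂`. -/
def biNormal (ρ : ℝ) : Measure (ℝ × ℝ) :=
  stdGauss2.map fun z => (z.1, ρ * z.1 + Real.sqrt (1 - ρ ^ 2) * z.2)

/-- The contamination mixture `P_{ε,ρ} = (1-ε) N(0,Σ₀) + ε N(0,Σ_ρ)`. -/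
def mixture (ε ρ : ℝ) : Measure (ℝ × ℝ) :=
  ENNReal.ofReal (1 - ε) • biNormal 0 + ENNReal.ofReal ε • biNormal ρ

/-- The `n`-fold product (i.i.d.) measure. -/
def iid (n : ℕ) (μ : Measure (ℝ × ℝ)) : Measure (Fin n → ℝ × ℝ) :=
  Measure.pi fun _ => μ
/-- The standard normal distribution function. -/
def Phi (t : ℝ) : ℝ := (stdGauss (Set.Iic t)).toReal

/-- `Ψ(t) = 2Φ(t) - 1`, the distribution function of the absolute value of a standard
normal. -/
def Psi (t : ℝ) : ℝ := 2 * Phi t - 1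

/-- The pairwise differences `Uᵢ = (Xᵢ - Yᵢ)/√2`. -/
def pairDiff (n : ℕ) (x : Fin n → ℝ × ℝ) (i : Fin n) : ℝ :=
  ((x i).1 - (x i).2) / Real.sqrt 2

/-- The empirical distribution function of `|U₁|, …, |Uₙ|`. -/
def empCdf (n : ℕ) (x : Fin n → ℝ × ℝ) (u : ℝ) : ℝ :=
  (Finset.univ.filter fun i : Fin n => |pairDiff n x i| ≤ u).card / n

/-- The higher criticism statistic
`HCₙ = sup_{u ≥ 0} √n (Fₙ(u) - Ψ(u)) / √(Ψ(u)(1-Ψ(u)))`. -/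
def HCstat (n : ℕ) (x : Fin n → ℝ × ℝ) : ℝ :=
  ⨆ u : {u : ℝ // 0 ≤ u},
    Real.sqrt n * (empCdf n x u.1 - Psi u.1) / Real.sqrt (Psi u.1 * (1 - Psi u.1))

lemma bernoulli_mgf_le {p l : ℝ} (hp0 : 0 ≤ p) (hp1 : p ≤ 1) (hl : |l| ≤ 1) :
    p * Real.exp (l * (1 - p)) + (1 - p) * Real.exp (l * (0 - p)) ≤
      Real.exp (l ^ 2 * (p * (1 - p))) := by
  have key : ∀ x : ℝ, |x| ≤ 1 → Real.exp x ≤ 1 + x + x ^ 2 := fun x hx => by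
    have := (abs_le.1 (Real.abs_exp_sub_one_sub_id_le hx)).2
    linarith
  have h1 := key (l * (1 - p)) (by
    rw [abs_mul]
    exact mul_le_one₀ hl (abs_nonneg _) (abs_le.2 ⟨by linarith, by linarith⟩))
  have h2 := key (l * (0 - p)) (by
    rw [abs_mul]
    exact mul_le_one₀ hl (abs_nonneg _) (abs_le.2 ⟨by linarith, by linarith⟩))
  have h3 := Real.add_one_le_exp (l ^ 2 * (p * (1 - p)))
  have h4 := mul_le_mul_of_nonneg_left h1 hp0
  have h5 := mul_le_mul_of_nonneg_left h2 (sub_nonneg.2 hp1)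
  nlinarith

/-- Exponential tail bound for the (two-sided, via the sign of `l`) deviation of a binomial count,
with a variance-sensitive exponent. -/
lemma measure_count_sub_ge_le {Ω : Type*} [MeasurableSpace Ω] (μ : Measure Ω)
    [IsProbabilityMeasure μ] {A : Set Ω} [DecidablePred (· ∈ A)] (hA : MeasurableSet A) (n : ℕ)
    {l : ℝ} (hl : |l| ≤ 1) (s : ℝ) :
    (Measure.pi fun _ : Fin n => μ).real
        {x | s ≤ l * ((Finset.univ.filter fun i => x i ∈ A).card - n * μ.real A)} ≤
      Real.exp (l ^ 2 * (n * (μ.real A * (1 - μ.real A))) - s) := by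
  set p := μ.real A with hp
  let f : Ω → ℝ := fun ω => Real.exp (l * (A.indicator 1 ω - p))
  have hf : ∀ x : Fin n → Ω, Real.exp (l * ((Finset.univ.filter fun i => x i ∈ A).card - n * p)) =
      ∏ i, f (x i) := by
    intro x
    simp only [f, ← Real.exp_sum, ← Finset.mul_sum, Finset.sum_sub_distrib]
    congr 3
    · rw [Finset.card_filter]
      push_cast
      exact Finset.sum_congr rfl fun i _ => by simp [Set.indicator_apply]
    · simp
  have hfi : ∫ ω, f ω ∂μ = p * Real.exp (l * (1 - p)) + (1 - p) * Real.exp (l * (0 - p)) := by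
    have hfe : f = fun ω => A.indicator (fun _ => Real.exp (l * (1 - p))) ω +
        Aᶜ.indicator (fun _ => Real.exp (l * (0 - p))) ω := by
      ext ω
      by_cases h : ω ∈ A <;> simp [f, h]
    rw [hfe, integral_add ((integrable_const _).indicator hA)
      ((integrable_const _).indicator hA.compl), integral_indicator_const _ hA,
      integral_indicator_const _ hA.compl, probReal_compl_eq_one_sub hA]
    simp [hp]
  have hmeas : Measurable f := by
    have : Measurable (A.indicator (1 : Ω → ℝ)) := measurable_one.indicator hA
    fun_prop
  have hint : Integrable f μ := by
    refine Integrable.of_bound hmeas.aestronglyMeasurable (Real.exp (|l| * (1 + |p|))) ?_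
    refine Eventually.of_forall fun ω => ?_
    rw [Real.norm_eq_abs, Real.abs_exp, Real.exp_le_exp]
    refine (le_abs_self _).trans ?_
    rw [abs_mul]
    refine mul_le_mul_of_nonneg_left ((abs_sub _ _).trans ?_) (abs_nonneg _)
    by_cases h : ω ∈ A <;> simp [h]
  have hmk := mul_meas_ge_le_integral_of_nonneg (μ := Measure.pi fun _ : Fin n => μ)
    (f := fun x => ∏ i, f (x i)) (Eventually.of_forall fun x =>
      Finset.prod_nonneg fun i _ => (Real.exp_pos _).le)
    (Integrable.fintype_prod (f := fun _ => f) fun _ => hint) (Real.exp s)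
  rw [integral_fintype_prod_eq_pow, hfi, Fintype.card_fin] at hmk
  have hset : {x : Fin n → Ω | s ≤ l * ((Finset.univ.filter fun i => x i ∈ A).card - n * p)} =
      {x | Real.exp s ≤ ∏ i, f (x i)} := by
    ext x
    simp only [Set.mem_ofPred_eq, ← hf, Real.exp_le_exp]
  rw [hset, Real.exp_sub, le_div_iff₀' (Real.exp_pos _)]
  refine hmk.trans ?_
  have := pow_le_pow_left₀ (by
    have := measureReal_nonneg (μ := μ) (s := A)
    have := measureReal_le_one (μ := μ) (s := A)
    have : 0 ≤ 1 - p := by linarith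
    positivity) (bernoulli_mgf_le (p := p) measureReal_nonneg measureReal_le_one hl) n
  refine this.trans (le_of_eq ?_)
  rw [← Real.exp_nat_mul]
  congr 1
  ring

instance : IsProbabilityMeasure stdGauss := by unfold stdGauss; infer_instance

instance : IsProbabilityMeasure stdGauss2 := by unfold stdGauss2; infer_instance

instance (r : ℝ) : IsProbabilityMeasure (biNormal r) :=
  Measure.isProbabilityMeasure_map (by fun_prop)

lemma isProbabilityMeasure_mixture {e r : ℝ} (he0 : 0 ≤ e) (he1 : e ≤ 1) :
    IsProbabilityMeasure (mixture e r) := by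
  refine ⟨?_⟩
  simp only [mixture, Measure.add_apply, Measure.smul_apply, measure_univ, smul_eq_mul, mul_one]
  rw [← ENNReal.ofReal_add (by linarith) he0]
  simp

instance : NullSingletonClass stdGauss := nullSingletonClass_gaussianReal one_ne_zero

lemma Phi_eq_integral (t : ℝ) : Phi t = ∫ x in Set.Iic t, gaussianPDFReal 0 1 x := by
  rw [Phi, stdGauss, gaussianReal_apply_eq_integral _ one_ne_zero, ENNReal.toReal_ofReal]
  exact integral_nonneg fun x => gaussianPDFReal_nonneg _ _ _

lemma Phi_sub_eq_integral (a b : ℝ) : Phi b - Phi a = ∫ x in a..b, gaussianPDFReal 0 1 x := by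
  rw [Phi_eq_integral, Phi_eq_integral]
  exact intervalIntegral.integral_Iic_sub_Iic (integrable_gaussianPDFReal 0 1).integrableOn
    (integrable_gaussianPDFReal 0 1).integrableOn

lemma continuous_Phi : Continuous Phi := by
  have h : Phi = fun t => Phi 0 + ∫ x in (0 : ℝ)..t, gaussianPDFReal 0 1 x := by
    ext t
    rw [← Phi_sub_eq_integral]
    ring
  rw [h]
  exact continuous_const.add
    (intervalIntegral.continuous_primitive (fun _ _ =>
      (integrable_gaussianPDFReal 0 1).intervalIntegrable) 0)

lemma continuous_Psi : Continuous Psi :=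
  (continuous_const.mul continuous_Phi).sub continuous_const

lemma strictMono_Phi : StrictMono Phi := by
  intro a b hab
  rw [← sub_pos, Phi_sub_eq_integral]
  exact intervalIntegral.intervalIntegral_pos_of_pos
    (integrable_gaussianPDFReal 0 1).intervalIntegrable
    (fun x => gaussianPDFReal_pos _ _ _ one_ne_zero) hab

lemma strictMono_Psi : StrictMono Psi := fun a b hab => by
  have := strictMono_Phi hab
  simp only [Psi]
  linarith

lemma tendsto_Psi_atTop : Tendsto Psi atTop (𝓝 1) := by
  have h : Tendsto Phi atTop (𝓝 1) := by
    have : Phi = cdf stdGauss := by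
      ext t
      rw [cdf_eq_real]
      rfl
    rw [this]
    exact tendsto_cdf_atTop _
  have := (h.const_mul 2).sub_const 1
  norm_num at this
  exact this

lemma Psi_lt_one (u : ℝ) : Psi u < 1 :=
  (strictMono_Psi (lt_add_one u)).trans_le
    (strictMono_Psi.monotone.ge_of_tendsto tendsto_Psi_atTop _)

lemma Phi_neg (u : ℝ) : Phi (-u) = 1 - Phi u := by
  have h1 : stdGauss.real (Set.Ioi u) = 1 - Phi u := by
    rw [← Set.compl_Iic, probReal_compl_eq_one_sub measurableSet_Iic]
    rfl
  have h2 : stdGauss (Set.Iic (-u)) = stdGauss (Set.Ici u) := by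
    have : stdGauss.map (fun x => -x) = stdGauss := by
      simp [stdGauss, gaussianReal_map_neg]
    nth_rewrite 1 [← this]
    rw [Measure.map_apply measurable_neg measurableSet_Iic]
    congr 1
    ext x
    simp
  have h3 : stdGauss (Set.Ici u) = stdGauss (Set.Ioi u) := by
    exact (measure_congr Ioi_ae_eq_Ici).symm
  rw [← h1, Phi, h2, h3]
  rfl

lemma Psi_zero : Psi 0 = 0 := by
  have := Phi_neg 0
  rw [neg_zero] at this
  rw [Psi]
  linarith

lemma Psi_pos {u : ℝ} (hu : 0 < u) : 0 < Psi u := Psi_zero ▸ strictMono_Psi hu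

lemma Psi_nonneg {u : ℝ} (hu : 0 ≤ u) : 0 ≤ Psi u := Psi_zero ▸ strictMono_Psi.monotone hu

lemma exists_Psi_eq {t : ℝ} (h0 : 0 ≤ t) (h1 : t < 1) : ∃ u, 0 ≤ u ∧ Psi u = t := by
  obtain ⟨b, hb, hb0⟩ := ((tendsto_Psi_atTop.eventually_const_lt h1).and
    (eventually_ge_atTop 0)).exists
  obtain ⟨u, hu, rfl⟩ := intermediate_value_Icc hb0 continuous_Psi.continuousOn
    (show t ∈ Set.Icc (Psi 0) (Psi b) from ⟨Psi_zero.trans_le h0, hb.le⟩)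
  exact ⟨u, hu.1, rfl⟩

lemma stdGauss_abs_le {u : ℝ} (hu : 0 ≤ u) : stdGauss.real {z | |z| ≤ u} = Psi u := by
  have hs : {z : ℝ | |z| ≤ u} = Set.Iic u \ Set.Iio (-u) := by
    ext z
    simp only [abs_le, Set.mem_ofPred_eq, Set.mem_sdiff, Set.mem_Iic, Set.mem_Iio, not_lt]
    tauto
  have h3 : stdGauss.real (Set.Iio (-u)) = Phi (-u) := by
    rw [Phi, Measure.real]
    congr 1
    exact measure_congr Iio_ae_eq_Iic
  rw [hs, measureReal_sdiff (fun z hz => by simp only [Set.mem_Iio, Set.mem_Iic] at *; linarith)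
    measurableSet_Iio, h3, Phi_neg, Psi]
  change Phi u - _ = _
  ring

lemma map_linear_stdGauss2 (a b c : ℝ) (hc : a ^ 2 + b ^ 2 = c ^ 2) :
    stdGauss2.map (fun z => a * z.1 + b * z.2) = stdGauss.map (c * ·) := by
  have h1 : (fun z : ℝ × ℝ => a * z.1 + b * z.2) =
      (fun z : ℝ × ℝ => z.1 + z.2) ∘ Prod.map (a * ·) (b * ·) := rfl
  rw [h1, ← Measure.map_map (by fun_prop) (by fun_prop), stdGauss2,
    ← Measure.map_prod_map _ _ (by fun_prop) (by fun_prop)]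
  simp only [stdGauss]
  rw [gaussianReal_map_const_mul, gaussianReal_map_const_mul, gaussianReal_map_const_mul]
  refine gaussianReal_conv_gaussianReal.trans ?_
  congr 1
  · simp
  · ext
    simp [hc]

/-- The normalized difference of the coordinates. -/
def normDiff (p : ℝ × ℝ) : ℝ := (p.1 - p.2) / Real.sqrt 2

lemma measurable_normDiff : Measurable normDiff := by
  unfold normDiff
  fun_prop

lemma map_normDiff_biNormal {r : ℝ} (h0 : 0 ≤ r) (h1 : r ≤ 1) :
    (biNormal r).map normDiff = stdGauss.map (Real.sqrt (1 - r) * ·) := by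
  rw [biNormal, Measure.map_map measurable_normDiff (by fun_prop),
    ← map_linear_stdGauss2 ((1 - r) / Real.sqrt 2) (-Real.sqrt (1 - r ^ 2) / Real.sqrt 2)]
  · congr 1
    ext z
    simp only [Function.comp, normDiff]
    ring
  · rw [div_pow, div_pow, neg_sq, Real.sq_sqrt (sub_nonneg.2 (pow_le_one₀ h0 h1)), Real.sq_sqrt (by norm_num),
      Real.sq_sqrt (by linarith)]
    ring

lemma measurableSet_normDiff_le (u : ℝ) : MeasurableSet {p | |normDiff p| ≤ u} :=
  measurableSet_le (by have := measurable_normDiff; fun_prop) measurable_const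

lemma biNormal_normDiff_le {r u : ℝ} (h0 : 0 ≤ r) (h1 : r < 1) (hu : 0 ≤ u) :
    (biNormal r).real {p | |normDiff p| ≤ u} = Psi (u / Real.sqrt (1 - r)) := by
  have hs : 0 < Real.sqrt (1 - r) := Real.sqrt_pos.2 (by linarith)
  rw [← stdGauss_abs_le (by positivity)]
  have h2 : MeasurableSet {z : ℝ | |z| ≤ u} := measurableSet_le (by fun_prop) measurable_const
  have : {p | |normDiff p| ≤ u} = normDiff ⁻¹' {z | |z| ≤ u} := rfl
  rw [this, ← map_measureReal_apply measurable_normDiff h2, map_normDiff_biNormal h0 h1.le,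
    map_measureReal_apply (by fun_prop) h2]
  congr 1
  ext z
  simp [abs_mul, abs_of_pos hs, le_div_iff₀' hs]

lemma biNormal_normDiff_eq_zero {r : ℝ} (h0 : 0 ≤ r) (h1 : r < 1) :
    biNormal r {p | normDiff p = 0} = 0 := by
  have hs : 0 < Real.sqrt (1 - r) := Real.sqrt_pos.2 (by linarith)
  have : {p | normDiff p = 0} = normDiff ⁻¹' {0} := rfl
  rw [this, ← Measure.map_apply measurable_normDiff (measurableSet_singleton _),
    map_normDiff_biNormal h0 h1.le, Measure.map_apply (by fun_prop) (measurableSet_singleton _)]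
  convert! measure_singleton (μ := stdGauss) 0 using 2
  ext z
  simp [hs.ne']

lemma exists_Psi_one_add_ge :
    ∃ c : ℝ, 0 < c ∧ ∀ r, 0 ≤ r → r < 1 → Psi 1 + c * r ≤ Psi (1 / Real.sqrt (1 - r)) := by
  refine ⟨gaussianPDFReal 0 1 2, gaussianPDFReal_pos _ _ _ one_ne_zero, fun r h0 h1 => ?_⟩
  have hs : 0 < Real.sqrt (1 - r) := Real.sqrt_pos.2 (by linarith)
  have h2 : 1 + r / 2 ≤ 1 / Real.sqrt (1 - r) := by
    rw [le_div_iff₀ hs]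
    have : Real.sqrt (1 - r) ≤ 1 - r / 2 := Real.sqrt_le_iff.2 ⟨by linarith, by nlinarith⟩
    nlinarith
  refine le_trans ?_ (strictMono_Psi.monotone h2)
  have h3 : r / 2 * gaussianPDFReal 0 1 2 ≤ Phi (1 + r / 2) - Phi 1 := by
    rw [Phi_sub_eq_integral]
    have := intervalIntegral.integral_mono_on (a := 1) (b := 1 + r / 2) (μ := volume)
      (f := fun _ => gaussianPDFReal 0 1 2) (g := gaussianPDFReal 0 1) (by linarith)
      intervalIntegrable_const (integrable_gaussianPDFReal 0 1).intervalIntegrable (by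
        intro x hx
        simp only [gaussianPDFReal]
        gcongr ?_ * Real.exp (-?_ / _)
        simp only [sub_zero]
        nlinarith [hx.1, hx.2])
    simpa using this
  simp only [Psi]
  linarith

/-- The success probability at threshold `1` exceeds its null value by a multiple of `e * r`. -/
lemma mixture_normDiff_le_one {c e r : ℝ}
    (hc : ∀ r, 0 ≤ r → r < 1 → Psi 1 + c * r ≤ Psi (1 / Real.sqrt (1 - r)))
    (he0 : 0 ≤ e) (he1 : e ≤ 1) (h0 : 0 ≤ r) (h1 : r < 1) :
    Psi 1 + c * (e * r) ≤ (mixture e r).real {p | |normDiff p| ≤ 1} := by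
  have h : (mixture e r).real {p | |normDiff p| ≤ 1} =
      (1 - e) * Psi 1 + e * Psi (1 / Real.sqrt (1 - r)) := by
    have hfin : ∀ a b : ℝ, (ENNReal.ofReal a • biNormal b) {p | |normDiff p| ≤ 1} ≠ ⊤ :=
      fun a b => ENNReal.mul_ne_top ENNReal.ofReal_ne_top (measure_ne_top _ _)
    rw [mixture, measureReal_add_apply (h₁ := hfin _ _) (h₂ := hfin _ _), measureReal_ennreal_smul_apply,
      measureReal_ennreal_smul_apply, biNormal_normDiff_le le_rfl one_pos zero_le_one,
      biNormal_normDiff_le h0 h1 zero_le_one, ENNReal.toReal_ofReal (by linarith),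
      ENNReal.toReal_ofReal he0]
    simp
  rw [h]
  nlinarith [hc r h0 h1]

/-- The number of observations with `|Uᵢ| ≤ u`. -/
def cnt (n : ℕ) (x : Fin n → ℝ × ℝ) (u : ℝ) : ℝ :=
  (Finset.univ.filter fun i : Fin n => |pairDiff n x i| ≤ u).card

lemma empCdf_eq (n : ℕ) (x : Fin n → ℝ × ℝ) (u : ℝ) : empCdf n x u = cnt n x u / n := rfl

lemma cnt_nonneg (n : ℕ) (x : Fin n → ℝ × ℝ) (u : ℝ) : 0 ≤ cnt n x u := Nat.cast_nonneg _

lemma cnt_le (n : ℕ) (x : Fin n → ℝ × ℝ) (u : ℝ) : cnt n x u ≤ n := by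
  have := Finset.card_filter_le (Finset.univ : Finset (Fin n)) fun i => |pairDiff n x i| ≤ u
  rw [Finset.card_univ, Fintype.card_fin] at this
  exact Nat.cast_le.2 this

lemma cnt_mono (n : ℕ) (x : Fin n → ℝ × ℝ) {u v : ℝ} (h : u ≤ v) : cnt n x u ≤ cnt n x v := by
  refine Nat.cast_le.2 (Finset.card_le_card ?_)
  exact Finset.monotone_filter_right _ fun i _ hi => hi.trans h

lemma cnt_eq_zero {n : ℕ} {x : Fin n → ℝ × ℝ} {u : ℝ} (h : ∀ i, u < |pairDiff n x i|) :
    cnt n x u = 0 := by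
  rw [cnt, Nat.cast_eq_zero, Finset.card_eq_zero, Finset.filter_eq_empty_iff]
  exact fun i _ => not_le.2 (h i)

/-- The normalized empirical deviation at threshold `u`. -/
def hcRatio (n : ℕ) (x : Fin n → ℝ × ℝ) (u : ℝ) : ℝ :=
  Real.sqrt n * (empCdf n x u - Psi u) / Real.sqrt (Psi u * (1 - Psi u))

lemma hcRatio_le {n : ℕ} {x : Fin n → ℝ × ℝ} {u K : ℝ} (hn : 0 < n) (hK : 0 ≤ K)
    (h : cnt n x u - n * Psi u ≤ K * Real.sqrt (n * (Psi u * (1 - Psi u)))) :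
    hcRatio n x u ≤ K := by
  have hn' : (0 : ℝ) < n := by exact_mod_cast hn
  refine div_le_of_le_mul₀ (Real.sqrt_nonneg _) hK ?_
  rw [Real.sqrt_mul hn'.le] at h
  refine le_of_mul_le_mul_left ?_ (Real.sqrt_pos.2 hn')
  have e : Real.sqrt n * (Real.sqrt n * (empCdf n x u - Psi u)) = cnt n x u - n * Psi u := by
    rw [← mul_assoc, Real.mul_self_sqrt hn'.le, empCdf_eq]
    field_simp
  rw [e]
  linarith

lemma le_hcRatio {n : ℕ} {x : Fin n → ℝ × ℝ} {u K : ℝ} (hn : 0 < n) (hu : 0 < u)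
    (h : K * Real.sqrt (n * (Psi u * (1 - Psi u))) ≤ cnt n x u - n * Psi u) :
    K ≤ hcRatio n x u := by
  have hn' : (0 : ℝ) < n := by exact_mod_cast hn
  have hpos : 0 < Psi u * (1 - Psi u) := mul_pos (Psi_pos hu) (sub_pos.2 (Psi_lt_one u))
  rw [hcRatio, le_div_iff₀ (Real.sqrt_pos.2 hpos)]
  rw [Real.sqrt_mul hn'.le] at h
  refine le_of_mul_le_mul_left ?_ (Real.sqrt_pos.2 hn')
  have e : Real.sqrt n * (Real.sqrt n * (empCdf n x u - Psi u)) = cnt n x u - n * Psi u := by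
    rw [← mul_assoc, Real.mul_self_sqrt hn'.le, empCdf_eq]
    field_simp
  rw [e]
  linarith

lemma hcRatio_le_zero {n : ℕ} {x : Fin n → ℝ × ℝ} {u : ℝ} (hn : 0 < n) (hu : 0 ≤ u)
    (h : ∀ i, u < |pairDiff n x i|) : hcRatio n x u ≤ 0 := by
  refine hcRatio_le hn le_rfl ?_
  rw [cnt_eq_zero h, zero_mul, zero_sub, neg_nonpos]
  exact mul_nonneg n.cast_nonneg (Psi_nonneg hu)

/-- For a threshold whose `Psi`-value is bounded below, the upper tail alone bounds the ratio. -/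
lemma hcRatio_le_of_mul_le {n : ℕ} {x : Fin n → ℝ × ℝ} {u K : ℝ} (hn : 0 < n) (hK : 0 ≤ K)
    (h : n * (1 - Psi u) ≤ K ^ 2 * Psi u) : hcRatio n x u ≤ K := by
  refine hcRatio_le hn hK ?_
  have h1 : 0 ≤ n * (1 - Psi u) := mul_nonneg n.cast_nonneg (sub_nonneg.2 (Psi_lt_one u).le)
  have h2 : n * (1 - Psi u) ≤ K * Real.sqrt (n * (Psi u * (1 - Psi u))) := by
    rw [← Real.sqrt_sq hK, ← Real.sqrt_mul (sq_nonneg K)]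
    refine Real.le_sqrt_of_sq_le ?_
    nlinarith [mul_le_mul_of_nonneg_left h h1]
  have := cnt_le n x u
  linarith

lemma bddAbove_hcRatio {n : ℕ} {x : Fin n → ℝ × ℝ} (hn : 0 < n) (h : ∀ i, pairDiff n x i ≠ 0) :
    BddAbove (Set.range fun u : {u : ℝ // 0 ≤ u} => hcRatio n x u.1) := by
  have : Nonempty (Fin n) := ⟨⟨0, hn⟩⟩
  obtain ⟨i, hi⟩ := Finite.exists_min fun i => |pairDiff n x i|
  have hm : 0 < |pairDiff n x i| := abs_pos.2 (h i)
  have hP := Psi_pos hm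
  refine ⟨Real.sqrt (n / Psi |pairDiff n x i|), ?_⟩
  rintro _ ⟨⟨u, hu⟩, rfl⟩
  rcases lt_or_ge u |pairDiff n x i| with hlt | hge
  · exact (hcRatio_le_zero hn hu fun j => hlt.trans_le (hi j)).trans (Real.sqrt_nonneg _)
  · refine hcRatio_le_of_mul_le hn (Real.sqrt_nonneg _) ?_
    have hle := strictMono_Psi.monotone hge
    rw [Real.sq_sqrt (by positivity), div_mul_eq_mul_div, le_div_iff₀ hP, mul_assoc]
    refine mul_le_mul_of_nonneg_left ?_ n.cast_nonneg
    nlinarith [Psi_nonneg hu]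

lemma HCstat_eq (n : ℕ) (x : Fin n → ℝ × ℝ) :
    HCstat n x = ⨆ u : {u : ℝ // 0 ≤ u}, hcRatio n x u.1 := rfl

lemma le_HCstat {n : ℕ} {x : Fin n → ℝ × ℝ} {u K : ℝ} (hn : 0 < n) (h : ∀ i, pairDiff n x i ≠ 0)
    (hu : 0 ≤ u) (hK : K ≤ hcRatio n x u) : K ≤ HCstat n x := by
  rw [HCstat_eq]
  exact hK.trans (le_ciSup (bddAbove_hcRatio hn h) ⟨u, hu⟩)

lemma HCstat_le {n : ℕ} {x : Fin n → ℝ × ℝ} {K : ℝ} (h : ∀ u, 0 ≤ u → hcRatio n x u ≤ K) :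
    HCstat n x ≤ K := by
  have : Nonempty {u : ℝ // 0 ≤ u} := ⟨⟨0, le_rfl⟩⟩
  rw [HCstat_eq]
  exact ciSup_le fun u => h u.1 u.2

/-- Control of the ratio in the bulk from control on the grid of `k / n`-quantiles. -/
lemma hcRatio_le_of_grid {n : ℕ} {x : Fin n → ℝ × ℝ} {L u : ℝ} {v : ℕ → ℝ} (hn : 0 < n)
    (hL : 10 ≤ L) (hv : ∀ k < n, Psi (v k) = k / n)
    (hgrid : ∀ k < n, 16 ≤ n * ((k / n : ℝ) * (1 - k / n)) →
      cnt n x (v k) < k + L / 2 * Real.sqrt (n * ((k / n : ℝ) * (1 - k / n))))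
    (h1 : 33 ≤ n * Psi u) (h2 : n * Psi u ≤ n - 33) :
    hcRatio n x u ≤ 7 / 8 * L := by
  have hn' : (0 : ℝ) < n := by exact_mod_cast hn
  set t := Psi u with ht
  obtain ⟨k, hk1, hk2⟩ : ∃ k : ℕ, n * t < k ∧ (k : ℝ) ≤ n * t + 1 :=
    ⟨⌊n * t⌋₊ + 1, by exact_mod_cast Nat.lt_floor_add_one _, by
      push_cast
      linarith [Nat.floor_le (show 0 ≤ n * t by linarith)]⟩
  have hkn : k < n := by
    have : (k : ℝ) < n := by linarith
    exact_mod_cast this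
  have hS : n * ((k / n : ℝ) * (1 - k / n)) = k * (n - k) / n := by
    field_simp
  have hT : n * (t * (1 - t)) = n * t * (n - n * t) / n := by
    field_simp
  have hlt : u < v k := by
    rw [← strictMono_Psi.lt_iff_lt, hv k hkn, ← ht, lt_div_iff₀ hn']
    linarith
  have h16 : 16 ≤ n * ((k / n : ℝ) * (1 - k / n)) := by
    rw [hS, le_div_iff₀ hn']
    nlinarith
  have hT1 : 1 ≤ n * (t * (1 - t)) := by
    rw [hT, le_div_iff₀ hn']
    nlinarith
  have hST : n * ((k / n : ℝ) * (1 - k / n)) ≤ (3 / 2) ^ 2 * (n * (t * (1 - t))) := by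
    rw [hS, hT, ← mul_div_assoc]
    refine div_le_div_of_nonneg_right ?_ hn'.le
    nlinarith [mul_le_mul (show (k : ℝ) ≤ (3 / 2) ^ 2 * (n * t) by linarith)
      (show (n : ℝ) - k ≤ n - n * t by linarith) (by linarith) (by linarith)]
  have hg := hgrid k hkn h16
  have hsq : Real.sqrt (n * ((k / n : ℝ) * (1 - k / n))) ≤
      3 / 2 * Real.sqrt (n * (t * (1 - t))) := by
    have := Real.sqrt_le_sqrt hST
    rwa [Real.sqrt_mul (sq_nonneg (3 / 2 : ℝ)), Real.sqrt_sq (by norm_num)] at this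
  have hs1 : 1 ≤ Real.sqrt (n * (t * (1 - t))) := Real.one_le_sqrt.2 hT1
  have hc := cnt_mono n x hlt.le
  refine hcRatio_le hn (by linarith) ?_
  nlinarith

/-- Control of the ratio for `Psi u` between `1 / (n L)` and `33 / n`. -/
lemma hcRatio_le_of_cnt_lt {n : ℕ} {x : Fin n → ℝ × ℝ} {L u : ℝ} (hn : 66 ≤ n)
    (hL : 10000 ≤ L) (hcnt : cnt n x u < 33 + Real.sqrt L / 4)
    (h1 : 1 / L ≤ n * Psi u) (h2 : n * Psi u ≤ 33) : hcRatio n x u ≤ 7 / 8 * L := by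
  have hn' : (66 : ℝ) ≤ n := by exact_mod_cast hn
  set t := Psi u with ht
  set s := Real.sqrt L with hs
  have hs2 : s ^ 2 = L := Real.sq_sqrt (by linarith)
  have hs100 : 100 ≤ s := Real.le_sqrt_of_sq_le (by linarith)
  have hLpos : 0 < 1 / L := by positivity
  have htpos : 0 < t := by
    by_contra hcon
    nlinarith
  have hthalf : t ≤ 1 / 2 := by nlinarith
  have hlow : 2 / (3 * s) ≤ Real.sqrt (n * (t * (1 - t))) := by
    refine Real.le_sqrt_of_sq_le ?_
    have e : (2 / (3 * s)) ^ 2 = 4 / 9 * (1 / L) := by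
      rw [div_pow, mul_pow, hs2]
      ring
    rw [e]
    nlinarith [mul_nonneg (show (0 : ℝ) ≤ n * t by positivity) (sub_nonneg.2 hthalf)]
  refine hcRatio_le (by omega) (by linarith) ?_
  have h3 : 7 / 8 * L * (2 / (3 * s)) = 7 / 12 * s := by
    rw [← hs2]
    field_simp
    norm_num
  have h4 := mul_le_mul_of_nonneg_left hlow (show 0 ≤ 7 / 8 * L by linarith)
  have : 0 ≤ n * t := by positivity
  linarith

/-- Deterministic bound on the higher criticism statistic outside the exceptional events. -/
lemma HCstat_le_of_events {n : ℕ} {x : Fin n → ℝ × ℝ} {L a b : ℝ} {v : ℕ → ℝ} (hn : 66 ≤ n)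
    (hL : 10000 ≤ L) (hv : ∀ k < n, Psi (v k) = k / n) (ha : Psi a = 1 / (n * L))
    (hb : Psi b = 33 / n) (hsmall : ∀ i, a < |pairDiff n x i|)
    (hcnt : cnt n x b < 33 + Real.sqrt L / 4)
    (hgrid : ∀ k < n, 16 ≤ n * ((k / n : ℝ) * (1 - k / n)) →
      cnt n x (v k) < k + L / 2 * Real.sqrt (n * ((k / n : ℝ) * (1 - k / n)))) :
    HCstat n x ≤ 7 / 8 * L := by
  have hn' : (66 : ℝ) ≤ n := by exact_mod_cast hn
  have hn0 : 0 < n := by omega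
  have hna : n * Psi a = 1 / L := by
    rw [ha]
    field_simp
  have hnb : n * Psi b = 33 := by
    rw [hb]
    field_simp
  refine HCstat_le fun u hu => ?_
  rcases le_or_gt u a with hua | hua
  · exact (hcRatio_le_zero hn0 hu fun i => hua.trans_lt (hsmall i)).trans (by linarith)
  rcases le_or_gt u b with hub | hub
  · refine hcRatio_le_of_cnt_lt hn hL ((cnt_mono n x hub).trans_lt hcnt) ?_ ?_
    · rw [← hna]
      exact mul_le_mul_of_nonneg_left (strictMono_Psi.monotone hua.le) n.cast_nonneg
    · rw [← hnb]
      exact mul_le_mul_of_nonneg_left (strictMono_Psi.monotone hub) n.cast_nonneg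
  have h33 : 33 ≤ n * Psi u := by
    rw [← hnb]
    exact mul_le_mul_of_nonneg_left (strictMono_Psi.monotone hub.le) n.cast_nonneg
  rcases le_or_gt (n * Psi u) (n - 33) with h | h
  · exact hcRatio_le_of_grid hn0 (by linarith) hv hgrid h33 h
  · refine hcRatio_le_of_mul_le hn0 (by linarith) ?_
    have : 1 / 2 ≤ Psi u := by
      by_contra hcon
      nlinarith
    nlinarith

instance (n : ℕ) (μ : Measure (ℝ × ℝ)) [IsProbabilityMeasure μ] :
    IsProbabilityMeasure (iid n μ) := by
  unfold iid
  infer_instance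

lemma iid_exists_le (n : ℕ) (μ : Measure (ℝ × ℝ)) [IsProbabilityMeasure μ] {A : Set (ℝ × ℝ)}
    (hA : MeasurableSet A) : (iid n μ).real {x | ∃ i, x i ∈ A} ≤ n * μ.real A := by
  have h : {x : Fin n → ℝ × ℝ | ∃ i, x i ∈ A} = ⋃ i, Function.eval i ⁻¹' A := by
    ext x
    simp
  rw [h]
  refine (measureReal_iUnion_fintype_le _).trans (le_of_eq ?_)
  have : ∀ i : Fin n, (iid n μ).real (Function.eval i ⁻¹' A) = μ.real A := fun i =>
    (measurePreserving_eval (fun _ : Fin n => μ) i).measureReal_preimage hA.nullMeasurableSet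
  simp [this]

lemma iid_cnt_le (n : ℕ) (μ : Measure (ℝ × ℝ)) [IsProbabilityMeasure μ] (u : ℝ) {l : ℝ}
    (hl : |l| ≤ 1) (s : ℝ) :
    (iid n μ).real {x | s ≤ l * (cnt n x u - n * μ.real {p | |normDiff p| ≤ u})} ≤
      Real.exp (l ^ 2 * (n * (μ.real {p | |normDiff p| ≤ u} *
        (1 - μ.real {p | |normDiff p| ≤ u}))) - s) := by
  classical
  have := measure_count_sub_ge_le μ (measurableSet_normDiff_le u) n hl s
  convert! this using 2

lemma null_normDiff_le {u : ℝ} (hu : 0 ≤ u) : (biNormal 0).real {p | |normDiff p| ≤ u} = Psi u := by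
  rw [biNormal_normDiff_le le_rfl one_pos hu]
  simp

/-- Nonasymptotic bound on the type I error. -/
lemma null_error_le {n : ℕ} (hn : 66 ≤ n) (hL : 10000 ≤ Real.log n) :
    (iid n (biNormal 0)).real {x | Real.log n ≤ HCstat n x} ≤
      1 / Real.log n + Real.exp (33 - Real.sqrt (Real.log n) / 4) +
        Real.exp (16 - Real.log n) := by
  set L := Real.log n with hLdef
  have hn' : (66 : ℝ) ≤ n := by exact_mod_cast hn
  have hquant : ∀ k : ℕ, ∃ u, 0 ≤ u ∧ (k < n → Psi u = k / n) := by
    intro k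
    by_cases hk : k < n
    · obtain ⟨u, h0, h1⟩ := exists_Psi_eq (t := (k : ℝ) / n) (by positivity)
        ((div_lt_one (by linarith)).2 (by exact_mod_cast hk))
      exact ⟨u, h0, fun _ => h1⟩
    · exact ⟨0, le_rfl, fun h => absurd h hk⟩
  choose v hv0 hv using hquant
  obtain ⟨a, ha0, ha⟩ := exists_Psi_eq (t := 1 / (n * L)) (by positivity)
    ((div_lt_one (by positivity)).2 (by nlinarith))
  obtain ⟨b, hb0, hb⟩ := exists_Psi_eq (t := 33 / n) (by positivity)
    ((div_lt_one (by positivity)).2 (by linarith))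
  let E₁ : Set (Fin n → ℝ × ℝ) := {x | ∃ i, x i ∈ {p | |normDiff p| ≤ a}}
  let E₂ : Set (Fin n → ℝ × ℝ) :=
    {x | Real.sqrt L / 4 ≤ 1 * (cnt n x b - n * (biNormal 0).real {p | |normDiff p| ≤ b})}
  let S : ℕ → ℝ := fun k => n * ((k / n : ℝ) * (1 - k / n))
  let E₃ : Fin n → Set (Fin n → ℝ × ℝ) := fun k =>
    {x | 16 ≤ S k ∧ k + L / 2 * Real.sqrt (S k) ≤ cnt n x (v k)}
  have hsub : {x | L ≤ HCstat n x} ⊆ E₁ ∪ E₂ ∪ ⋃ k, E₃ k := by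
    intro x hx
    by_contra hcon
    simp only [Set.mem_union, not_or, Set.mem_iUnion, not_exists] at hcon
    obtain ⟨⟨hE1, hE2⟩, hE3⟩ := hcon
    have hle := HCstat_le_of_events (x := x) hn hL (fun k hk => hv k hk) ha hb
      (fun i => not_le.1 fun hi => hE1 ⟨i, hi⟩)
      (by
        have h : ¬ Real.sqrt L / 4 ≤
            1 * (cnt n x b - n * (biNormal 0).real {p | |normDiff p| ≤ b}) := hE2
        rw [null_normDiff_le hb0, hb, mul_div_cancel₀ _ (by positivity)] at h
        linarith)
      (fun k hk h16 => not_le.1 fun h => hE3 ⟨k, hk⟩ ⟨h16, h⟩)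
    have hx' : L ≤ HCstat n x := hx
    linarith
  have h1 : (iid n (biNormal 0)).real E₁ ≤ 1 / L := by
    refine (iid_exists_le n _ (measurableSet_normDiff_le a)).trans (le_of_eq ?_)
    rw [null_normDiff_le ha0, ha]
    field_simp
  have h2 : (iid n (biNormal 0)).real E₂ ≤ Real.exp (33 - Real.sqrt L / 4) := by
    refine (iid_cnt_le n _ b (by norm_num) _).trans (Real.exp_le_exp.2 ?_)
    rw [null_normDiff_le hb0]
    have : n * (Psi b * (1 - Psi b)) ≤ 33 := by
      have e : n * Psi b = 33 := by
        rw [hb]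
        field_simp
      nlinarith [Psi_nonneg hb0]
    linarith
  have h3 : ∀ k, (iid n (biNormal 0)).real (E₃ k) ≤ Real.exp (16 - 2 * L) := by
    intro k
    by_cases h16 : 16 ≤ S k
    · have hs : 0 < Real.sqrt (S k) := Real.sqrt_pos.2 (by linarith)
      have hs4 : 4 ≤ Real.sqrt (S k) := Real.le_sqrt_of_sq_le (by linarith)
      have hPk : Psi (v k) = k / n := hv k k.2
      have hb := iid_cnt_le n (biNormal 0) (v k) (l := 4 / Real.sqrt (S k))
        (by rw [abs_of_pos (by positivity), div_le_one hs]; exact hs4) (2 * L)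
      rw [null_normDiff_le (hv0 k), hPk] at hb
      refine (measureReal_mono ?_).trans (hb.trans (le_of_eq ?_))
      · rintro x ⟨-, hx⟩
        have hx' : L / 2 * Real.sqrt (S k) ≤ cnt n x (v k) - n * ((k : ℝ) / n) := by
          rw [mul_div_cancel₀ _ (by positivity)]
          linarith
        have := mul_le_mul_of_nonneg_left hx' (show 0 ≤ 4 / Real.sqrt (S k) by positivity)
        refine le_trans (le_of_eq ?_) this
        field_simp
        norm_num
      · congr 2
        change (4 / Real.sqrt (S k)) ^ 2 * S k = 16
        rw [div_pow, Real.sq_sqrt (by linarith)]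
        field_simp
        norm_num
    · have : E₃ k = ∅ := by
        ext x
        simp [E₃, h16]
      rw [this, measureReal_empty]
      positivity
  have h3' : (iid n (biNormal 0)).real (⋃ k, E₃ k) ≤ Real.exp (16 - L) := by
    refine (measureReal_iUnion_fintype_le _).trans ((Finset.sum_le_sum fun k _ => h3 k).trans ?_)
    rw [Finset.sum_const, Finset.card_univ, Fintype.card_fin, nsmul_eq_mul]
    have : (n : ℝ) = Real.exp L := (Real.exp_log (by linarith)).symm
    rw [this, ← Real.exp_add]
    exact Real.exp_le_exp.2 (by linarith)
  refine (measureReal_mono hsub).trans ((measureReal_union_le _ _).trans ?_)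
  have := measureReal_union_le (μ := iid n (biNormal 0)) E₁ E₂
  linarith

lemma mixture_normDiff_eq_zero {e r : ℝ} (h0 : 0 ≤ r) (h1 : r < 1) :
    mixture e r {p | normDiff p = 0} = 0 := by
  simp [mixture, biNormal_normDiff_eq_zero h0 h1, biNormal_normDiff_eq_zero le_rfl one_pos]

/-- Nonasymptotic bound on the type II error. -/
lemma alt_error_le {n : ℕ} {c e r : ℝ} (hn : 0 < n)
    (hc : ∀ r, 0 ≤ r → r < 1 → Psi 1 + c * r ≤ Psi (1 / Real.sqrt (1 - r)))
    (he0 : 0 ≤ e) (he1 : e ≤ 1) (h0 : 0 ≤ r) (h1 : r < 1) (hL : 0 ≤ Real.log n) :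
    1 - (iid n (mixture e r)).real {x | Real.log n ≤ HCstat n x} ≤
      Real.exp (1 - (c * (Real.sqrt n * (e * r)) - Real.log n)) := by
  have := isProbabilityMeasure_mixture (r := r) he0 he1
  set L := Real.log n with hLdef
  have hn' : (0 : ℝ) < n := by exact_mod_cast hn
  have hsq : 0 < Real.sqrt n := Real.sqrt_pos.2 hn'
  have hsqn : Real.sqrt n * Real.sqrt n = n := Real.mul_self_sqrt hn'.le
  set p := (mixture e r).real {p | |normDiff p| ≤ 1} with hp
  have hp1 : Psi 1 + c * (e * r) ≤ p := mixture_normDiff_le_one hc he0 he1 h0 h1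
  let Z : Set (Fin n → ℝ × ℝ) := {x | ∃ i, x i ∈ {p | normDiff p = 0}}
  let B : Set (Fin n → ℝ × ℝ) :=
    {x | c * (Real.sqrt n * (e * r)) - L ≤ -(1 / Real.sqrt n) * (cnt n x 1 - n * p)}
  have hcover : Set.univ ⊆ {x | L ≤ HCstat n x} ∪ (B ∪ Z) := by
    intro x _
    by_contra hcon
    simp only [Set.mem_union, not_or] at hcon
    obtain ⟨hS, hB, hZ⟩ := hcon
    refine hS (le_HCstat hn (fun i hi => hZ ⟨i, hi⟩) zero_le_one
      (le_hcRatio hn one_pos ?_))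
    have hB' : -(1 / Real.sqrt n) * (cnt n x 1 - n * p) < c * (Real.sqrt n * (e * r)) - L :=
      not_le.1 hB
    have h2 := mul_lt_mul_of_pos_left hB' hsq
    have e1 : Real.sqrt n * (-(1 / Real.sqrt n) * (cnt n x 1 - n * p)) = n * p - cnt n x 1 := by
      field_simp
      ring
    have e2 : Real.sqrt n * (c * (Real.sqrt n * (e * r)) - L) =
        n * (c * (e * r)) - L * Real.sqrt n := by
      linear_combination (c * (e * r)) * hsqn
    rw [e1, e2] at h2
    have h3 := mul_le_mul_of_nonneg_left hp1 hn'.le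
    have h4 : Real.sqrt (n * (Psi 1 * (1 - Psi 1))) ≤ Real.sqrt n := by
      refine Real.sqrt_le_sqrt (mul_le_of_le_one_right hn'.le ?_)
      nlinarith [Psi_lt_one 1, Psi_pos one_pos]
    have h5 := mul_le_mul_of_nonneg_left h4 hL
    linarith
  have hZ : (iid n (mixture e r)).real Z ≤ 0 := by
    refine (iid_exists_le n _ ?_).trans (le_of_eq ?_)
    · exact measurable_normDiff (measurableSet_singleton 0)
    · rw [Measure.real, mixture_normDiff_eq_zero h0 h1]
      simp
  have hB : (iid n (mixture e r)).real B ≤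
      Real.exp (1 - (c * (Real.sqrt n * (e * r)) - L)) := by
    have hl : |-(1 / Real.sqrt n)| ≤ 1 := by
      rw [abs_neg, abs_of_pos (by positivity), div_le_one hsq]
      exact Real.one_le_sqrt.2 (by exact_mod_cast hn)
    refine (iid_cnt_le n _ 1 hl _).trans (Real.exp_le_exp.2 ?_)
    rw [← hp]
    have e1 : (-(1 / Real.sqrt n)) ^ 2 * (n * (p * (1 - p))) = p * (1 - p) := by
      rw [neg_sq, div_pow, Real.sq_sqrt hn'.le]
      field_simp
    rw [e1]
    nlinarith [sq_nonneg (p - 1 / 2)]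
  have h := measureReal_mono (μ := iid n (mixture e r)) hcover
  rw [probReal_univ] at h
  have h6 := measureReal_union_le (μ := iid n (mixture e r)) {x | L ≤ HCstat n x} (B ∪ Z)
  have h7 := measureReal_union_le (μ := iid n (mixture e r)) B Z
  linarith

lemma tendsto_signal {c δ : ℝ} (hc : 0 < c) (hδ : 0 < δ) :
    Tendsto (fun n : ℕ => c * (n : ℝ) ^ δ - Real.log n) atTop atTop := by
  have h1 : Tendsto (fun x : ℝ => c * x ^ δ - Real.log x) atTop atTop := by
    have hb := (isLittleO_log_rpow_atTop hδ).bound (half_pos hc)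
    refine tendsto_atTop_mono' atTop (f₁ := fun x : ℝ => c / 2 * x ^ δ) ?_
      ((tendsto_rpow_atTop hδ).const_mul_atTop (half_pos hc))
    filter_upwards [hb, eventually_ge_atTop 0] with x hx hx0
    rw [Real.norm_eq_abs, Real.norm_eq_abs, abs_of_nonneg (Real.rpow_nonneg hx0 δ)] at hx
    linarith [le_abs_self (Real.log x)]
  exact h1.comp tendsto_natCast_atTop_atTop

/-- in the dense regime with `γ < 1/2 - β`, the higher criticism test
rejecting when `HCₙ ≥ log n` is asymptotically powerful. -/
theorem HC_dense_powerful (β γ : ℝ) (hβ0 : 0 < β) (hγ0 : 0 < γ) (hdense : γ < 1 / 2 - β)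
    (ε ρ : ℕ → ℝ) (hε : ∀ n : ℕ, ε n = (n : ℝ) ^ (-β)) (hρ : ∀ n : ℕ, ρ n = (n : ℝ) ^ (-γ)) :
    Tendsto (fun n =>
      ((iid n (biNormal 0)) {x : Fin n → ℝ × ℝ | Real.log n ≤ HCstat n x}).toReal
        + (1 - ((iid n (mixture (ε n) (ρ n)))
            {x : Fin n → ℝ × ℝ | Real.log n ≤ HCstat n x}).toReal))
      atTop (𝓝 0) := by
  obtain ⟨c, hc0, hc⟩ := exists_Psi_one_add_ge
  have hlog : Tendsto (fun n : ℕ => Real.log n) atTop atTop :=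
    Real.tendsto_log_atTop.comp tendsto_natCast_atTop_atTop
  have hneg : ∀ (a : ℝ) {f : ℕ → ℝ}, Tendsto f atTop atTop →
      Tendsto (fun n => Real.exp (a - f n)) atTop (𝓝 0) := fun a f hf =>
    Real.tendsto_exp_atBot.comp (tendsto_const_nhds.add_atBot (tendsto_neg_atTop_atBot.comp hf))
  have hbound : Tendsto (fun n : ℕ => 1 / Real.log n +
      Real.exp (33 - Real.sqrt (Real.log n) / 4) + Real.exp (16 - Real.log n) +
      Real.exp (1 - (c * (n : ℝ) ^ (1 / 2 - β - γ) - Real.log n))) atTop (𝓝 0) := by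
    have := (((tendsto_const_nhds (x := (1 : ℝ))).div_atTop hlog).add
      (hneg 33 ((Real.tendsto_sqrt_atTop.comp hlog).atTop_div_const
        (show (0 : ℝ) < 4 by norm_num)))).add
      (hneg 16 hlog) |>.add (hneg 1 (tendsto_signal hc0 (show 0 < 1 / 2 - β - γ by linarith)))
    simpa using this
  refine squeeze_zero' ?_ ?_ hbound
  · filter_upwards [eventually_ge_atTop 1] with n hn
    have hn' : (1 : ℝ) ≤ n := by exact_mod_cast hn
    have := isProbabilityMeasure_mixture (e := ε n) (r := ρ n)
      (by rw [hε]; positivity)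
      (by rw [hε]; exact Real.rpow_le_one_of_one_le_of_nonpos hn' (by linarith))
    have h := measureReal_le_one (μ := iid n (mixture (ε n) (ρ n)))
      (s := {x | Real.log n ≤ HCstat n x})
    rw [Measure.real] at h
    linarith [ENNReal.toReal_nonneg
      (a := (iid n (biNormal 0)) {x : Fin n → ℝ × ℝ | Real.log n ≤ HCstat n x})]
  · filter_upwards [eventually_ge_atTop 66, hlog.eventually_ge_atTop 10000] with n hn hL
    have hn' : (66 : ℝ) ≤ n := by exact_mod_cast hn
    have h1 := null_error_le hn hL
    have h2 := alt_error_le (n := n) (e := ε n) (r := ρ n) (by omega) hc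
      (by rw [hε]; positivity)
      (by rw [hε]; exact Real.rpow_le_one_of_one_le_of_nonpos (by linarith) (by linarith))
      (by rw [hρ]; positivity)
      (by rw [hρ]; exact Real.rpow_lt_one_of_one_lt_of_neg (by linarith) (by linarith))
      (by linarith)
    have e : Real.sqrt n * (ε n * ρ n) = (n : ℝ) ^ (1 / 2 - β - γ) := by
      rw [hε, hρ, Real.sqrt_eq_rpow, ← Real.rpow_add (by linarith), ← Real.rpow_add (by linarith)]
      congr 1
      ring
    rw [e] at h2
    exact add_le_add h1 h2
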